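/- The averaging identity σ_μ(z,τ) = (1/k)·Σ_{a=0}^{k−1} σ_{(μ+a)/k}(z, τ/k) holds for every positive integer k. -/

import Mathlib

open Complex

/-- Jacobi theta function `θ₁(z,τ) = Σ_{n∈ℤ+1/2} exp(iπn²τ + 2πin(z+1/2))`. -/
noncomputable def theta1 (z τ : ℂ) : ℂ :=
  ∑' n : ℤ, Complex.exp (Real.pi * I * ((n : ℂ) + 1/2)^2 * τ +
    2 * Real.pi * I * ((n : ℂ) + 1/2) * (z + 1/2))

/-- `θ₁′(0,τ)`, the derivative of `θ₁` in the first variable at `0`. -/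
noncomputable def theta1'0 (τ : ℂ) : ℂ := deriv (fun w => theta1 w τ) 0

/-- The function `σ_μ(z) = θ₁(z−μ,τ)θ₁′(0,τ)/(θ₁(z,τ)θ₁(−μ,τ))`. -/
noncomputable def sigmaE (τ μ z : ℂ) : ℂ :=
  theta1 (z - μ) τ * theta1'0 τ / (theta1 z τ * theta1 (-μ) τ)

/-- The lattice `ℤ + τℤ`. -/
def lattice (τ : ℂ) : Set ℂ := {w | ∃ m n : ℤ, w = (m : ℂ) + (n : ℂ) * τ}

open Filter Topology

/-- The bilateral Lambert series `∑ yⁿ / (1 - x qⁿ)`. -/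
noncomputable def lambertKernel (q x y : ℂ) : ℂ :=
  ∑' n : ℤ, y ^ n / (1 - x * q ^ n)

/-- The sign with which the monomial `xⁱ yⁿ qⁿⁱ` occurs in the double power series expansion of
`lambertKernel q x y` on the domain `|q| < |x|, |y| < 1`. -/
noncomputable def quadrantSign (i n : ℤ) : ℂ :=
  if 0 ≤ i ∧ 0 ≤ n then 1 else if i < 0 ∧ n < 0 then -1 else 0

lemma norm_quadrantSign_le (i n : ℤ) : ‖quadrantSign i n‖ ≤ 1 := by
  unfold quadrantSign
  split_ifs <;> simp

lemma quadrantSign_add_one {i n : ℤ} (hn : n ≠ -1) :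
    quadrantSign i (n + 1) = quadrantSign i n := by
  unfold quadrantSign
  have h1 : 0 ≤ n + 1 ↔ 0 ≤ n := by omega
  have h2 : n + 1 < 0 ↔ n < 0 := by omega
  simp only [h1, h2]

lemma quadrantSign_zero_right (i : ℤ) : quadrantSign i 0 = quadrantSign i (-1) + 1 := by
  unfold quadrantSign
  rcases lt_or_ge i 0 with h | h
  · simp [h, not_le.mpr h]
  · simp [h, not_lt.mpr h]

lemma norm_mul_zpow_lt_one {q x : ℂ} (hq : ‖q‖ < 1) (hx : ‖x‖ < 1) {n : ℤ} (hn : 0 ≤ n) :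
    ‖x * q ^ n‖ < 1 := by
  lift n to ℕ using hn
  rw [zpow_natCast, norm_mul, norm_pow]
  calc ‖x‖ * ‖q‖ ^ n ≤ ‖x‖ * 1 := by
        gcongr
        exact pow_le_one₀ (norm_nonneg _) hq.le
    _ < 1 := by simpa using hx

lemma norm_inv_mul_zpow_lt_one {q x : ℂ} (hq0 : q ≠ 0) (hq : ‖q‖ < 1) (hx : ‖q‖ < ‖x‖) {n : ℤ}
    (hn : n < 0) : ‖(x * q ^ n)⁻¹‖ < 1 := by
  have hx0 : 0 < ‖x‖ := (norm_nonneg q).trans_lt hx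
  obtain ⟨m, rfl⟩ : ∃ m : ℕ, n = -((m : ℤ) + 1) := ⟨(-n - 1).toNat, by omega⟩
  have : (x * q ^ (-((m : ℤ) + 1)))⁻¹ = q * x⁻¹ * q ^ (m : ℤ) := by
    rw [zpow_neg, zpow_add₀ hq0]
    field_simp
  rw [this]
  refine norm_mul_zpow_lt_one hq ?_ (by positivity)
  rw [norm_mul, norm_inv, ← div_eq_mul_inv, div_lt_one hx0]
  exact hx

lemma hasSum_quadrantSign_mul_zpow {q x : ℂ} (hq0 : q ≠ 0) (hq : ‖q‖ < 1) (hxq : ‖q‖ < ‖x‖)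
    (hx : ‖x‖ < 1) (n : ℤ) :
    HasSum (fun i : ℤ => quadrantSign i n * (x * q ^ n) ^ i) (1 / (1 - x * q ^ n)) := by
  have hx0 : x ≠ 0 := norm_pos_iff.mp ((norm_nonneg q).trans_lt hxq)
  have hu0 : x * q ^ n ≠ 0 := mul_ne_zero hx0 (zpow_ne_zero _ hq0)
  rcases lt_or_ge n 0 with hn | hn
  · have hu := norm_inv_mul_zpow_lt_one hq0 hq hxq hn
    set u := x * q ^ n with hu_def
    have h := (hasSum_geometric_of_norm_lt_one hu).mul_left (-u⁻¹)
    have hval : 1 / (1 - u) = 0 + -u⁻¹ * (1 - u⁻¹)⁻¹ := by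
      have : u ≠ 1 := by
        rintro h1
        simp [h1] at hu
      have h2 : 1 - u ≠ 0 := sub_ne_zero.mpr this.symm
      have h3 : u - 1 ≠ 0 := sub_ne_zero.mpr this
      have h4 : 1 - u⁻¹ = (u - 1) / u := by field_simp
      rw [h4]
      field_simp
      ring
    rw [hval]
    refine HasSum.of_nat_of_neg_add_one ?_ ?_
    · refine hasSum_zero.congr_fun fun m => ?_
      rw [quadrantSign, if_neg (by omega), if_neg (by omega), zero_mul]
    · refine h.congr_fun fun m => ?_
      have : -((m : ℤ) + 1) < 0 := by omega
      rw [quadrantSign, if_neg (by omega), if_pos ⟨this, hn⟩, zpow_neg, zpow_add₀ hu0]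
      simp
  · have hu := norm_mul_zpow_lt_one hq hx hn
    have h := hasSum_geometric_of_norm_lt_one hu
    rw [one_div, ← add_zero (1 - x * q ^ n)⁻¹]
    refine HasSum.of_nat_of_neg_add_one ?_ ?_
    · refine h.congr_fun fun m => ?_
      simp [quadrantSign, hn]
    · refine hasSum_zero.congr_fun fun m => ?_
      rw [quadrantSign, if_neg (by omega), if_neg (by omega), zero_mul]

lemma summable_pow_natAbs {r : ℝ} (h0 : 0 ≤ r) (h1 : r < 1) :
    Summable fun n : ℤ => r ^ n.natAbs := by
  refine Summable.of_nat_of_neg_add_one ?_ ?_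
  · simpa using summable_geometric_of_lt_one h0 h1
  · have h := (summable_geometric_of_lt_one h0 h1).mul_left r
    refine (summable_congr fun m => ?_).mpr h
    rw [show (-((m : ℤ) + 1)).natAbs = m + 1 by omega, pow_succ']

lemma zpow_neg_mul_pow_eq {q : ℝ} {y : ℝ} (hy : y ≠ 0) (a : ℕ) :
    y ^ (-(a : ℤ)) * q ^ a = (q / y) ^ a := by
  rw [zpow_neg, zpow_natCast, div_pow]
  field_simp

lemma summable_norm_quadrantSign_mul {q x y : ℂ} (hq0 : q ≠ 0) (hq : ‖q‖ < 1)
    (hxq : ‖q‖ < ‖x‖) (hx : ‖x‖ < 1) (hyq : ‖q‖ < ‖y‖) (hy : ‖y‖ < 1) :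
    Summable fun p : ℤ × ℤ => ‖y ^ p.1 * (quadrantSign p.2 p.1 * (x * q ^ p.1) ^ p.2)‖ := by
  have hQ : 0 < ‖q‖ := norm_pos_iff.mpr hq0
  have hX : 0 < ‖x‖ := hQ.trans hxq
  have hY : 0 < ‖y‖ := hQ.trans hyq
  set r := max ‖y‖ (‖q‖ / ‖y‖)
  set s := max ‖x‖ (‖q‖ / ‖x‖)
  have hr0 : 0 ≤ r := le_max_of_le_left (norm_nonneg y)
  have hs0 : 0 ≤ s := le_max_of_le_left (norm_nonneg x)
  have hr : r < 1 := max_lt hy ((div_lt_one hY).mpr hyq)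
  have hs : s < 1 := max_lt hx ((div_lt_one hX).mpr hxq)
  have hB := ((summable_pow_natAbs hr0 hr).mul_of_nonneg (summable_pow_natAbs hs0 hs)
    (fun _ => by positivity) (fun _ => by positivity)).mul_left (‖q‖⁻¹)
  refine Summable.of_nonneg_of_le (fun _ => norm_nonneg _) ?_ hB
  rintro ⟨n, i⟩
  have h1q : 1 ≤ ‖q‖⁻¹ := (one_le_inv₀ hQ).mpr hq.le
  dsimp only
  by_cases h : 0 ≤ i ∧ 0 ≤ n
  · obtain ⟨hi, hn⟩ := h
    lift i to ℕ using hi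
    lift n to ℕ using hn
    simp only [quadrantSign, Int.natCast_nonneg, and_self, if_true, one_mul, zpow_natCast,
      norm_mul, norm_pow, Int.natAbs_natCast, mul_pow]
    calc ‖y‖ ^ n * (‖x‖ ^ i * (‖q‖ ^ n) ^ i) ≤ r ^ n * (s ^ i * 1) := by
          gcongr
          · exact le_max_left _ _
          · exact le_max_left _ _
          · exact pow_le_one₀ (by positivity) (pow_le_one₀ (by positivity) hq.le)
      _ = 1 * (r ^ n * s ^ i) := by ring
      _ ≤ _ := by gcongr
  by_cases h' : i < 0 ∧ n < 0
  · obtain ⟨a, rfl⟩ : ∃ m : ℕ, n = -((m + 1 : ℕ) : ℤ) := ⟨(-n - 1).toNat, by omega⟩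
    obtain ⟨b, rfl⟩ : ∃ m : ℕ, i = -((m + 1 : ℕ) : ℤ) := ⟨(-i - 1).toNat, by omega⟩
    rw [quadrantSign, if_neg h, if_pos h', Int.natAbs_neg, Int.natAbs_neg, Int.natAbs_natCast,
      Int.natAbs_natCast, mul_zpow, ← zpow_mul]
    have hexp : -((a + 1 : ℕ) : ℤ) * -((b + 1 : ℕ) : ℤ) = (((a + 1) * (b + 1) : ℕ) : ℤ) := by
      push_cast
      ring
    rw [hexp, norm_mul, norm_mul, norm_mul, norm_neg, norm_one, one_mul, norm_zpow, norm_zpow,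
      norm_zpow, zpow_natCast]
    have hpow : ‖q‖ ^ ((a + 1) * (b + 1)) ≤ ‖q‖⁻¹ * (‖q‖ ^ (a + 1) * ‖q‖ ^ (b + 1)) := by
      have : ‖q‖⁻¹ * (‖q‖ ^ (a + 1) * ‖q‖ ^ (b + 1)) = ‖q‖ ^ (a + b + 1) := by
        field_simp
        ring
      rw [this]
      exact pow_le_pow_of_le_one hQ.le hq.le (by nlinarith [Nat.zero_le (a * b)])
    calc ‖y‖ ^ (-((a + 1 : ℕ) : ℤ)) * (‖x‖ ^ (-((b + 1 : ℕ) : ℤ)) * ‖q‖ ^ ((a + 1) * (b + 1)))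
        ≤ ‖y‖ ^ (-((a + 1 : ℕ) : ℤ)) * (‖x‖ ^ (-((b + 1 : ℕ) : ℤ)) *
          (‖q‖⁻¹ * (‖q‖ ^ (a + 1) * ‖q‖ ^ (b + 1)))) := by gcongr
      _ = ‖q‖⁻¹ * ((‖y‖ ^ (-((a + 1 : ℕ) : ℤ)) * ‖q‖ ^ (a + 1)) *
          (‖x‖ ^ (-((b + 1 : ℕ) : ℤ)) * ‖q‖ ^ (b + 1))) := by ring
      _ = ‖q‖⁻¹ * ((‖q‖ / ‖y‖) ^ (a + 1) * (‖q‖ / ‖x‖) ^ (b + 1)) := by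
          rw [zpow_neg_mul_pow_eq hY.ne', zpow_neg_mul_pow_eq hX.ne']
      _ ≤ ‖q‖⁻¹ * (r ^ (a + 1) * s ^ (b + 1)) := by
          gcongr
          · exact le_max_right _ _
          · exact le_max_right _ _
  · rw [quadrantSign, if_neg h, if_neg h', zero_mul, mul_zero, norm_zero]
    positivity

section ThetaCoefficients

variable {q : ℂ} {b : ℤ → ℂ}

lemma tsum_eq_zero_of_antisymm (hb : ∀ j, b (-1 - j) = -b j) : ∑' j, b j = 0 := by
  have h := (Equiv.subLeft (-1 : ℤ)).tsum_eq b
  simp only [Equiv.subLeft_apply, hb, tsum_neg] at h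
  exact self_eq_neg.mp h.symm

/-- The coefficient of `x ^ N` in the product of the `n`-th row of the expansion of
`lambertKernel q x y` with `∑ b j x ^ j`. -/
noncomputable def rowCoeff (q y : ℂ) (b : ℤ → ℂ) (N n : ℤ) : ℂ :=
  ∑' j : ℤ, y ^ n * (quadrantSign (N - j) n * ((q ^ n) ^ (N - j) * b j))

lemma rowCoeff_add_one {y : ℂ} (hq0 : q ≠ 0) (hy0 : y ≠ 0)
    (hrec : ∀ j, b (j + 1) = -q ^ (j + 1) * b j) (hanti : ∀ j, b (-1 - j) = -b j)
    (hsum : ∀ w : ℂ, w ≠ 0 → Summable fun j => ‖b j * w ^ j‖) (N n : ℤ) :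
    rowCoeff q y b (N + 1) (n + 1) = -y * q ^ (N + 1) * rowCoeff q y b N n := by
  unfold rowCoeff
  rw [← (Equiv.addRight (1 : ℤ)).tsum_eq]
  simp only [Equiv.coe_addRight, add_sub_add_right_eq_sub, hrec]
  have hq : ∀ j, (q ^ (n + 1)) ^ (N - j) * q ^ (j + 1) = q ^ (N + 1) * (q ^ n) ^ (N - j) := by
    intro j
    rw [← zpow_mul, ← zpow_mul, ← zpow_add₀ hq0, ← zpow_add₀ hq0]
    congr 1
    ring
  have hterm : ∀ j, y ^ (n + 1) * (quadrantSign (N - j) (n + 1) *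
      ((q ^ (n + 1)) ^ (N - j) * (-q ^ (j + 1) * b j))) =
      -y * q ^ (N + 1) * (y ^ n * (quadrantSign (N - j) (n + 1) * ((q ^ n) ^ (N - j) * b j))) := by
    intro j
    rw [zpow_add_one₀ hy0]
    linear_combination (-(y ^ n * y * quadrantSign (N - j) (n + 1) * b j)) * hq j
  simp only [hterm, tsum_mul_left]
  congr 2
  by_cases hn : n = -1
  · subst hn
    have hw : ∀ j, (q ^ (-1 : ℤ)) ^ (N - j) * b j = q ^ (-N) * (b j * q ^ j) := by
      intro j
      rw [← zpow_mul, show (-1 : ℤ) * (N - j) = -N + j by ring, zpow_add₀ hq0]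
      ring
    have hs : Summable fun j => q ^ (-N) * (b j * q ^ j) := ((hsum q hq0).of_norm).mul_left _
    have hs' : Summable fun j => quadrantSign (N - j) (-1) * (q ^ (-N) * (b j * q ^ j)) := by
      refine Summable.of_norm_bounded hs.norm fun j => ?_
      rw [norm_mul]
      exact mul_le_of_le_one_left (norm_nonneg _) (norm_quadrantSign_le _ _)
    have hz : ∑' j, b j * q ^ j = 0 := by
      have h1 : ∀ j, b j * q ^ j = -q⁻¹ * b (j + 1) := by
        intro j
        rw [hrec, zpow_add_one₀ hq0]
        field_simp
      simp only [h1, tsum_mul_left]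
      rw [show ∑' j, b (j + 1) = ∑' j, b j from (Equiv.addRight (1 : ℤ)).tsum_eq b,
        tsum_eq_zero_of_antisymm hanti, mul_zero]
    simp only [neg_add_cancel, quadrantSign_zero_right, hw, add_mul, one_mul]
    rw [hs'.tsum_add hs, tsum_mul_left (a := q ^ (-N)), hz, mul_zero, add_zero]
  · simp only [quadrantSign_add_one hn]

lemma exists_tsum_rowCoeff_eq {y : ℂ} (hq0 : q ≠ 0) (hy0 : y ≠ 0) (hb0 : ∀ j, b j ≠ 0)
    (hrec : ∀ j, b (j + 1) = -q ^ (j + 1) * b j) (hanti : ∀ j, b (-1 - j) = -b j)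
    (hsum : ∀ w : ℂ, w ≠ 0 → Summable fun j => ‖b j * w ^ j‖) :
    ∃ C : ℂ, ∀ N, ∑' n, rowCoeff q y b N n = C * (b N * y ^ N) := by
  have hstep : ∀ N, ∑' n, rowCoeff q y b (N + 1) n =
      -y * q ^ (N + 1) * ∑' n, rowCoeff q y b N n := by
    intro N
    rw [← (Equiv.addRight (1 : ℤ)).tsum_eq, ← tsum_mul_left]
    exact tsum_congr fun n => rowCoeff_add_one hq0 hy0 hrec hanti hsum N n
  have hstep' : ∀ N, b (N + 1) * y ^ (N + 1) = -y * q ^ (N + 1) * (b N * y ^ N) := by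
    intro N
    rw [hrec, zpow_add_one₀ hy0]
    ring
  refine ⟨(∑' n, rowCoeff q y b 0 n) / b 0, fun N => ?_⟩
  induction N using Int.induction_on with
  | zero => simp [div_mul_cancel₀ _ (hb0 0)]
  | succ i ih =>
    rw [hstep, hstep', ih]
    ring
  | pred i ih =>
    have h1 := hstep (-(i : ℤ) - 1)
    have h2 := hstep' (-(i : ℤ) - 1)
    rw [sub_add_cancel] at h1 h2
    rw [h1, h2] at ih
    have hc : -y * q ^ (-(i : ℤ)) ≠ 0 := mul_ne_zero (neg_ne_zero.mpr hy0) (zpow_ne_zero _ hq0)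
    exact mul_left_cancel₀ hc (by linear_combination ih)

theorem exists_lambertKernel_mul_tsum_eq {y : ℂ} (hq0 : q ≠ 0) (hq : ‖q‖ < 1)
    (hyq : ‖q‖ < ‖y‖) (hy : ‖y‖ < 1) (hb0 : ∀ j, b j ≠ 0)
    (hrec : ∀ j, b (j + 1) = -q ^ (j + 1) * b j) (hanti : ∀ j, b (-1 - j) = -b j)
    (hsum : ∀ w : ℂ, w ≠ 0 → Summable fun j => ‖b j * w ^ j‖) :
    ∃ C : ℂ, ∀ x : ℂ, ‖q‖ < ‖x‖ → ‖x‖ < 1 →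
      lambertKernel q x y * ∑' j, b j * x ^ j = C * ∑' j, b j * (x * y) ^ j := by
  have hy0 : y ≠ 0 := norm_pos_iff.mp ((norm_nonneg q).trans_lt hyq)
  obtain ⟨C, hC⟩ := exists_tsum_rowCoeff_eq hq0 hy0 hb0 hrec hanti hsum
  refine ⟨C, fun x hxq hx => ?_⟩
  have hx0 : x ≠ 0 := norm_pos_iff.mp ((norm_nonneg q).trans_lt hxq)
  have hF := summable_norm_quadrantSign_mul hq0 hq hxq hx hyq hy
  have hK : lambertKernel q x y =
      ∑' p : ℤ × ℤ, y ^ p.1 * (quadrantSign p.2 p.1 * (x * q ^ p.1) ^ p.2) := by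
    rw [hF.of_norm.tsum_prod, lambertKernel]
    refine tsum_congr fun n => ?_
    dsimp only
    rw [tsum_mul_left, (hasSum_quadrantSign_mul_zpow hq0 hq hxq hx n).tsum_eq, mul_one_div]
  let e : ℤ × (ℤ × ℤ) ≃ (ℤ × ℤ) × ℤ :=
    { toFun := fun p => ((p.2.1, p.1 - p.2.2), p.2.2)
      invFun := fun p => (p.1.2 + p.2, (p.1.1, p.2))
      left_inv := fun p => by simp
      right_inv := fun p => by simp }
  have hS := (summable_mul_of_summable_norm hF (hsum x hx0)).comp_injective e.injective
  rw [hK, tsum_mul_tsum_of_summable_norm hF (hsum x hx0), ← e.tsum_eq, ← tsum_mul_left]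
  refine (hS.tsum_prod).trans (tsum_congr fun N => ?_)
  refine ((hS.prod_factor N).tsum_prod).trans ?_
  have hterm : ∀ n j : ℤ, y ^ n * (quadrantSign (N - j) n * (x * q ^ n) ^ (N - j)) * (b j * x ^ j) =
      x ^ N * (y ^ n * (quadrantSign (N - j) n * ((q ^ n) ^ (N - j) * b j))) := by
    intro n j
    rw [mul_zpow, show x ^ N = x ^ (N - j) * x ^ j by rw [← zpow_add₀ hx0, sub_add_cancel]]
    ring
  have : ∀ n : ℤ, ∑' j : ℤ, ((fun p : (ℤ × ℤ) × ℤ => y ^ p.1.1 * (quadrantSign p.1.2 p.1.1 *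
      (x * q ^ p.1.1) ^ p.1.2) * (b p.2 * x ^ p.2)) ∘ e) (N, (n, j)) =
      x ^ N * rowCoeff q y b N n := by
    intro n
    rw [rowCoeff, ← tsum_mul_left]
    exact tsum_congr fun j => hterm n j
  rw [tsum_congr this, tsum_mul_left, hC N, mul_zpow]
  ring

end ThetaCoefficients

section LambertKernel

variable {q x y : ℂ}

lemma lambertKernel_mul_left (hq0 : q ≠ 0) (hy0 : y ≠ 0) :
    lambertKernel q (x * q) y = y⁻¹ * lambertKernel q x y := by
  unfold lambertKernel
  rw [← (Equiv.addRight (1 : ℤ)).tsum_eq fun n => y ^ n / (1 - x * q ^ n), ← tsum_mul_left]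
  refine tsum_congr fun n => ?_
  rw [Equiv.coe_addRight, zpow_add_one₀ hy0, zpow_add_one₀ hq0, mul_comm (q ^ n) q, ← mul_assoc]
  field_simp

lemma summable_lambertKernel_mul_left_iff (hq0 : q ≠ 0) (hy0 : y ≠ 0) :
    (Summable fun n : ℤ => y ^ n / (1 - x * q * q ^ n)) ↔
      Summable fun n : ℤ => y ^ n / (1 - x * q ^ n) := by
  rw [← (Equiv.addRight (1 : ℤ)).summable_iff (f := fun n => y ^ n / (1 - x * q ^ n)),
    ← summable_mul_left_iff (f := fun n : ℤ => y ^ n / (1 - x * q * q ^ n)) hy0]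
  refine summable_congr fun n => ?_
  rw [Function.comp_apply, Equiv.coe_addRight, zpow_add_one₀ hy0, zpow_add_one₀ hq0,
    mul_comm (q ^ n) q, ← mul_assoc]
  ring

lemma norm_zpow_div_one_sub_le (hq0 : q ≠ 0) (hyq : ‖q‖ < ‖y‖) {ρ : ℝ} (hρ : ‖q‖ < ρ)
    (hxρ : ρ ≤ ‖x‖) (hx : ‖x‖ ≤ 1) {n : ℤ} (hn : n ≠ 0) :
    ‖y ^ n / (1 - x * q ^ n)‖ ≤
      (1 - ‖q‖ / ρ)⁻¹ * ρ⁻¹ * max ‖y‖ (‖q‖ / ‖y‖) ^ n.natAbs := by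
  have hQ : 0 < ‖q‖ := norm_pos_iff.mpr hq0
  have hρ0 : 0 < ρ := hQ.trans hρ
  have hX : 0 < ‖x‖ := hρ0.trans_le hxρ
  have hY : 0 < ‖y‖ := hQ.trans hyq
  have hq : ‖q‖ < 1 := hρ.trans_le (hxρ.trans hx)
  have hd : 0 < 1 - ‖q‖ / ρ := sub_pos.mpr ((div_lt_one hρ0).mpr hρ)
  rcases lt_or_gt_of_ne hn with h | h
  · obtain ⟨m, rfl⟩ : ∃ m : ℕ, n = -((m + 1 : ℕ) : ℤ) := ⟨(-n - 1).toNat, by omega⟩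
    rw [Int.natAbs_neg, Int.natAbs_natCast]
    have hu0 : x * q ^ (-((m + 1 : ℕ) : ℤ)) ≠ 0 :=
      mul_ne_zero (norm_pos_iff.mp hX) (zpow_ne_zero _ hq0)
    set u := x * q ^ (-((m + 1 : ℕ) : ℤ)) with hu_def
    have hinv : ‖u⁻¹‖ = ‖q‖ ^ (m + 1) / ‖x‖ := by
      rw [hu_def, zpow_neg, zpow_natCast, mul_inv, inv_inv, norm_mul, norm_inv, norm_pow]
      field_simp
    have hinv1 : ‖u⁻¹‖ ≤ ‖q‖ ^ (m + 1) * ρ⁻¹ := by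
      rw [hinv, div_eq_mul_inv]
      gcongr
    have hinv2 : ‖u⁻¹‖ ≤ ‖q‖ / ρ := by
      refine hinv1.trans ?_
      rw [div_eq_mul_inv]
      gcongr
      exact pow_le_of_le_one hQ.le hq.le (by omega)
    have hlow : 1 - ‖q‖ / ρ ≤ ‖u⁻¹ - 1‖ := by
      have := norm_sub_norm_le (1 : ℂ) u⁻¹
      rw [norm_one, norm_sub_rev] at this
      linarith
    have heq : y ^ (-((m + 1 : ℕ) : ℤ)) / (1 - u) =
        y ^ (-((m + 1 : ℕ) : ℤ)) * u⁻¹ * (u⁻¹ - 1)⁻¹ := by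
      rw [show u⁻¹ - 1 = (1 - u) / u by field_simp, inv_div]
      field_simp
    rw [heq, norm_mul, norm_mul, norm_zpow, norm_inv (u⁻¹ - 1)]
    calc ‖y‖ ^ (-((m + 1 : ℕ) : ℤ)) * ‖u⁻¹‖ * ‖u⁻¹ - 1‖⁻¹
        ≤ ‖y‖ ^ (-((m + 1 : ℕ) : ℤ)) * (‖q‖ ^ (m + 1) * ρ⁻¹) * (1 - ‖q‖ / ρ)⁻¹ := by gcongr
      _ = (1 - ‖q‖ / ρ)⁻¹ * ρ⁻¹ * (‖y‖ ^ (-((m + 1 : ℕ) : ℤ)) * ‖q‖ ^ (m + 1)) := by ring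
      _ = (1 - ‖q‖ / ρ)⁻¹ * ρ⁻¹ * (‖q‖ / ‖y‖) ^ (m + 1) := by rw [zpow_neg_mul_pow_eq hY.ne']
      _ ≤ _ := by
        gcongr
        exact le_max_right _ _
  · obtain ⟨m, rfl⟩ : ∃ m : ℕ, n = ((m + 1 : ℕ) : ℤ) := ⟨(n - 1).toNat, by omega⟩
    rw [Int.natAbs_natCast, zpow_natCast, zpow_natCast, norm_div, norm_pow, div_eq_mul_inv]
    have hρ1 : 1 ≤ ρ⁻¹ := (one_le_inv₀ hρ0).mpr (hxρ.trans hx)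
    have hlow : 1 - ‖q‖ / ρ ≤ ‖1 - x * q ^ (m + 1)‖ := by
      have h1 := norm_sub_norm_le (1 : ℂ) (x * q ^ (m + 1))
      rw [norm_one, norm_mul, norm_pow] at h1
      have h2 : ‖x‖ * ‖q‖ ^ (m + 1) ≤ 1 * ‖q‖ := by
        gcongr
        exact pow_le_of_le_one hQ.le hq.le (by omega)
      have h3 : ‖q‖ ≤ ‖q‖ / ρ := by
        rw [div_eq_mul_inv]
        exact le_mul_of_one_le_right hQ.le hρ1
      linarith
    calc ‖y‖ ^ (m + 1) * ‖1 - x * q ^ (m + 1)‖⁻¹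
        ≤ max ‖y‖ (‖q‖ / ‖y‖) ^ (m + 1) * (1 - ‖q‖ / ρ)⁻¹ := by
          gcongr
          exact le_max_left _ _
      _ = (1 - ‖q‖ / ρ)⁻¹ * 1 * max ‖y‖ (‖q‖ / ‖y‖) ^ (m + 1) := by ring
      _ ≤ _ := by gcongr

lemma summable_lambertKernel_bound (hq0 : q ≠ 0) (hyq : ‖q‖ < ‖y‖) (hy : ‖y‖ < 1) :
    Summable fun n : ℤ => max ‖y‖ (‖q‖ / ‖y‖) ^ n.natAbs :=
  summable_pow_natAbs (le_max_of_le_left (norm_nonneg y))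
    (max_lt hy ((div_lt_one ((norm_pos_iff.mpr hq0).trans hyq)).mpr hyq))

lemma summable_lambertKernel (hq0 : q ≠ 0) (hxq : ‖q‖ < ‖x‖) (hx : ‖x‖ ≤ 1) (hyq : ‖q‖ < ‖y‖)
    (hy : ‖y‖ < 1) : Summable fun n : ℤ => y ^ n / (1 - x * q ^ n) := by
  refine Summable.of_norm_bounded_eventually
    ((summable_lambertKernel_bound hq0 hyq hy).mul_left ((1 - ‖q‖ / ‖x‖)⁻¹ * ‖x‖⁻¹)) ?_
  filter_upwards [(Set.finite_singleton (0 : ℤ)).compl_mem_cofinite] with n hn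
  exact norm_zpow_div_one_sub_le hq0 hyq hxq le_rfl hx hn

lemma tendsto_one_sub_mul_lambertKernel_aux (hq0 : q ≠ 0) (hyq : ‖q‖ < ‖y‖) (hy : ‖y‖ < 1)
    {x₀ : ℂ} (hx₀ : ‖x₀‖ = 1) :
    Tendsto (fun x => (1 - x) * lambertKernel q x y) (𝓝[Metric.ball 0 1] x₀)
      (𝓝 (∑' n : ℤ, if n = 0 then 1 else (1 - x₀) * (y ^ n / (1 - x₀ * q ^ n)))) := by
  have hq : ‖q‖ < 1 := hyq.trans hy
  obtain ⟨ρ, hρ, hρ1⟩ := exists_between hq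
  have hQ : 0 < ‖q‖ := norm_pos_iff.mpr hq0
  have hρ0 : 0 < ρ := hQ.trans hρ
  have hM : 1 ≤ (1 - ‖q‖ / ρ)⁻¹ * ρ⁻¹ := by
    have h1 : 0 < 1 - ‖q‖ / ρ := sub_pos.mpr ((div_lt_one hρ0).mpr hρ)
    have h2 : 1 - ‖q‖ / ρ ≤ 1 := by
      have : 0 ≤ ‖q‖ / ρ := by positivity
      linarith
    nlinarith [(one_le_inv₀ h1).mpr h2, (one_le_inv₀ hρ0).mpr hρ1.le]
  simp only [lambertKernel, ← tsum_mul_left]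
  refine tendsto_tsum_of_dominated_convergence
    (bound := fun n => 2 * ((1 - ‖q‖ / ρ)⁻¹ * ρ⁻¹ * max ‖y‖ (‖q‖ / ‖y‖) ^ n.natAbs))
    (((summable_lambertKernel_bound hq0 hyq hy).mul_left _).mul_left _) ?_ ?_
  · intro n
    by_cases hn : n = 0
    · subst hn
      refine tendsto_const_nhds.congr' ?_
      filter_upwards [self_mem_nhdsWithin] with x hx
      have : 1 - x ≠ 0 := by
        rintro h
        rw [← sub_eq_zero.mp h] at hx
        simp at hx
      simp [this]
    · rw [if_neg hn]
      have hne : 1 - x₀ * q ^ n ≠ 0 := by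
        intro h
        have h1 := congrArg norm (sub_eq_zero.mp h)
        rw [norm_one, norm_mul, hx₀, one_mul, norm_zpow] at h1
        exact hn ((zpow_eq_one_iff_right₀ hQ.le hq.ne).mp h1.symm)
      have hcont : ContinuousAt (fun x : ℂ => (1 - x) * (y ^ n / (1 - x * q ^ n))) x₀ := by
        fun_prop (disch := exact hne)
      exact hcont.tendsto.mono_left nhdsWithin_le_nhds
  · have h1 : ∀ᶠ x : ℂ in 𝓝[Metric.ball 0 1] x₀, ρ < ‖x‖ :=
      nhdsWithin_le_nhds (continuous_norm.continuousAt.eventually_const_lt (hρ1.trans_eq hx₀.symm))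
    filter_upwards [h1, self_mem_nhdsWithin] with x hxρ hx n
    rw [mem_ball_zero_iff] at hx
    by_cases hn : n = 0
    · subst hn
      have : 1 - x ≠ 0 := by
        rintro h
        rw [← sub_eq_zero.mp h] at hx
        simp at hx
      simp only [zpow_zero, mul_one, one_div, Int.natAbs_zero, pow_zero, mul_inv_cancel₀ this,
        norm_one]
      linarith
    · rw [norm_mul]
      gcongr
      · calc ‖1 - x‖ ≤ ‖(1 : ℂ)‖ + ‖x‖ := norm_sub_le _ _
          _ ≤ 2 := by
            rw [norm_one]
            linarith
      · exact norm_zpow_div_one_sub_le hq0 hyq hρ hxρ.le hx.le hn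

lemma tendsto_one_sub_mul_lambertKernel_one (hq0 : q ≠ 0) (hyq : ‖q‖ < ‖y‖) (hy : ‖y‖ < 1) :
    Tendsto (fun x => (1 - x) * lambertKernel q x y) (𝓝[Metric.ball 0 1] 1) (𝓝 1) := by
  have h := tendsto_one_sub_mul_lambertKernel_aux hq0 hyq hy norm_one
  simpa using h

lemma tendsto_one_sub_mul_lambertKernel (hq0 : q ≠ 0) (hyq : ‖q‖ < ‖y‖) (hy : ‖y‖ < 1)
    {x₀ : ℂ} (hx₀ : ‖x₀‖ = 1) (hne : x₀ ≠ 1) :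
    Tendsto (fun x => (1 - x) * lambertKernel q x y) (𝓝[Metric.ball 0 1] x₀)
      (𝓝 ((1 - x₀) * lambertKernel q x₀ y)) := by
  have h := tendsto_one_sub_mul_lambertKernel_aux hq0 hyq hy hx₀
  have heq : ∀ n : ℤ, (if n = 0 then 1 else (1 - x₀) * (y ^ n / (1 - x₀ * q ^ n))) =
      (1 - x₀) * (y ^ n / (1 - x₀ * q ^ n)) := by
    intro n
    split_ifs with hn
    · subst hn
      simp [mul_inv_cancel₀ (sub_ne_zero.mpr hne.symm)]
    · rfl
  rwa [tsum_congr heq, tsum_mul_left] at h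

lemma sum_primitiveRoot_mul_zpow {k : ℕ} {ζ : ℂ} (hζ : IsPrimitiveRoot ζ k)
    (w : ℂ) (n : ℤ) :
    ∑ a ∈ Finset.range k, (w * ζ ^ a) ^ n = if (k : ℤ) ∣ n then (k : ℂ) * w ^ n else 0 := by
  have h1 : ∀ a : ℕ, (w * ζ ^ a) ^ n = w ^ n * (ζ ^ n) ^ a := by
    intro a
    rw [mul_zpow, ← zpow_natCast ζ a, ← zpow_mul, mul_comm (a : ℤ) n, zpow_mul, zpow_natCast]
  simp only [h1, ← Finset.mul_sum]
  split_ifs with h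
  · rw [(hζ.zpow_eq_one_iff_dvd n).mpr h]
    simp [mul_comm]
  · have h2 : ζ ^ n - 1 ≠ 0 := sub_ne_zero.mpr fun h' => h ((hζ.zpow_eq_one_iff_dvd n).mp h')
    have h3 : (ζ ^ n) ^ k = 1 := by
      rw [← zpow_natCast, ← zpow_mul, mul_comm, zpow_mul, zpow_natCast, hζ.pow_eq_one, one_zpow]
    have h4 := mul_geom_sum (ζ ^ n) k
    rw [h3, sub_self] at h4
    rw [(mul_eq_zero.mp h4).resolve_left h2, mul_zero]

theorem sum_lambertKernel_primitiveRoot {k : ℕ} {ζ w : ℂ} (hk : 0 < k)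
    (hζ : IsPrimitiveRoot ζ k)
    (hs : ∀ a ∈ Finset.range k, Summable fun n : ℤ => (w * ζ ^ a) ^ n / (1 - x * q ^ n)) :
    ∑ a ∈ Finset.range k, lambertKernel q x (w * ζ ^ a) =
      k * lambertKernel (q ^ k) x (w ^ k) := by
  unfold lambertKernel
  rw [← Summable.tsum_finsetSum hs, ← tsum_mul_left]
  simp only [← Finset.sum_div, sum_primitiveRoot_mul_zpow hζ]
  have hinj : Function.Injective fun m : ℤ => (k : ℤ) * m :=
    mul_right_injective₀ (by exact_mod_cast hk.ne')
  rw [← hinj.tsum_eq]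
  · refine tsum_congr fun m => ?_
    rw [if_pos (dvd_mul_right _ _), zpow_mul, zpow_mul, zpow_natCast, zpow_natCast, mul_div_assoc]
  · intro n hn
    by_contra h
    refine hn ?_
    dsimp only
    rw [if_neg fun ⟨m, hm⟩ => h ⟨m, hm.symm⟩, zero_div]

end LambertKernel

/-- The function `e^{2πiz}`. -/
noncomputable def expTwoPiI (z : ℂ) : ℂ := exp (2 * Real.pi * I * z)

lemma expTwoPiI_ne_zero (z : ℂ) : expTwoPiI z ≠ 0 := exp_ne_zero _

lemma expTwoPiI_add (z w : ℂ) : expTwoPiI (z + w) = expTwoPiI z * expTwoPiI w := by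
  simp only [expTwoPiI, mul_add, exp_add]

lemma expTwoPiI_neg (z : ℂ) : expTwoPiI (-z) = (expTwoPiI z)⁻¹ := by
  simp only [expTwoPiI, mul_neg, exp_neg]

lemma expTwoPiI_zero : expTwoPiI 0 = 1 := by simp [expTwoPiI]

lemma norm_expTwoPiI (z : ℂ) : ‖expTwoPiI z‖ = Real.exp (-(2 * Real.pi * z.im)) := by
  rw [expTwoPiI, norm_exp]
  simp

lemma norm_expTwoPiI_lt {z w : ℂ} (h : w.im < z.im) : ‖expTwoPiI z‖ < ‖expTwoPiI w‖ := by
  rw [norm_expTwoPiI, norm_expTwoPiI, Real.exp_lt_exp]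
  nlinarith [Real.pi_pos]

lemma norm_expTwoPiI_lt_one {z : ℂ} (h : 0 < z.im) : ‖expTwoPiI z‖ < 1 := by
  simpa [expTwoPiI_zero] using norm_expTwoPiI_lt (z := z) (w := 0) (by simpa using h)

lemma norm_expTwoPiI_eq_one {z : ℂ} (h : z.im = 0) : ‖expTwoPiI z‖ = 1 := by
  simp [norm_expTwoPiI, h]

lemma continuous_expTwoPiI : Continuous expTwoPiI := by
  unfold expTwoPiI
  fun_prop

lemma hasDerivAt_expTwoPiI_zero : HasDerivAt expTwoPiI (2 * Real.pi * I) 0 := by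
  have h := ((hasDerivAt_id (0 : ℂ)).const_mul (2 * Real.pi * I)).cexp
  simpa using h.congr_of_eventuallyEq (f₁ := expTwoPiI) (.of_forall fun _ => rfl)

lemma expTwoPiI_ne_one {z τ : ℂ} (hz : z ∉ lattice τ) : expTwoPiI z ≠ 1 := by
  intro h
  obtain ⟨n, hn⟩ := exp_eq_one_iff.mp h
  refine hz ⟨n, 0, ?_⟩
  have h2 : (2 * Real.pi * I : ℂ) ≠ 0 := two_pi_I_ne_zero
  rw [mul_comm] at hn
  simpa using mul_right_cancel₀ h2 hn

lemma add_mem_lattice_iff {z τ : ℂ} : z + τ ∈ lattice τ ↔ z ∈ lattice τ := by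
  constructor
  · rintro ⟨m, n, h⟩
    refine ⟨m, n - 1, ?_⟩
    push_cast
    linear_combination h
  · rintro ⟨m, n, h⟩
    refine ⟨m, n + 1, ?_⟩
    push_cast
    linear_combination h

lemma neg_mem_lattice_iff {z τ : ℂ} : -z ∈ lattice τ ↔ z ∈ lattice τ := by
  constructor <;>
  · rintro ⟨m, n, h⟩
    refine ⟨-m, -n, ?_⟩
    push_cast
    linear_combination -h

/-- A property invariant under translation by `τ` holds everywhere as soon as it holds on the
fundamental strip `0 ≤ Im z < Im τ`. -/
lemma forall_of_forall_strip {τ : ℂ} (hτ : 0 < τ.im) {P : ℂ → Prop}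
    (hshift : ∀ z, P (z + τ) ↔ P z) (hstrip : ∀ z : ℂ, 0 ≤ z.im → z.im < τ.im → P z) (z : ℂ) :
    P z := by
  have hint : ∀ (n : ℤ) (w : ℂ), P (w + n * τ) ↔ P w := by
    intro n w
    induction n using Int.induction_on with
    | zero => simp
    | succ i ih =>
      rw [← ih, ← hshift (w + ((i : ℤ) : ℂ) * τ)]
      push_cast
      ring_nf
    | pred i ih =>
      rw [← ih, ← hshift (w + ((-(i : ℤ) - 1 : ℤ) : ℂ) * τ)]
      push_cast
      ring_nf
  obtain ⟨n, hn, -⟩ := existsUnique_add_zsmul_mem_Ico hτ z.im 0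
  rw [← hint n]
  rw [zsmul_eq_mul, zero_add] at hn
  refine hstrip _ ?_ ?_
  · simpa using hn.1
  · simpa using hn.2

section Theta

variable {τ : ℂ}

/-- The coefficients of `e^{-πiz} θ₁(z, τ)` as a Laurent series in `e^{2πiz}`. -/
noncomputable def theta1Coeff (τ : ℂ) (j : ℤ) : ℂ :=
  exp (Real.pi * I * ((j : ℂ) + 1 / 2) ^ 2 * τ + Real.pi * I * ((j : ℂ) + 1 / 2))

lemma theta1Coeff_ne_zero (τ : ℂ) (j : ℤ) : theta1Coeff τ j ≠ 0 := exp_ne_zero _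

lemma theta1Coeff_add_one (τ : ℂ) (j : ℤ) :
    theta1Coeff τ (j + 1) = -expTwoPiI τ ^ (j + 1) * theta1Coeff τ j := by
  have h : -expTwoPiI τ ^ (j + 1) = exp (Real.pi * I + ((j + 1 : ℤ) : ℂ) * (2 * Real.pi * I * τ)) := by
    rw [exp_add, exp_pi_mul_I, exp_int_mul, expTwoPiI]
    ring
  rw [h, theta1Coeff, theta1Coeff, ← exp_add]
  congr 1
  push_cast
  ring

lemma theta1Coeff_neg_one_sub (τ : ℂ) (j : ℤ) :
    theta1Coeff τ (-1 - j) = -theta1Coeff τ j := by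
  have h : -1 = exp (-(Real.pi * I) + ((-j : ℤ) : ℂ) * (2 * Real.pi * I)) := by
    rw [exp_add, exp_int_mul_two_pi_mul_I, exp_neg, exp_pi_mul_I]
    norm_num
  rw [neg_eq_neg_one_mul (theta1Coeff τ j), h, theta1Coeff, theta1Coeff, ← exp_add]
  congr 1
  push_cast
  ring

lemma theta1Coeff_mul_expTwoPiI_zpow (τ z : ℂ) (j : ℤ) :
    theta1Coeff τ j * expTwoPiI z ^ j =
      exp (Real.pi * I * τ / 4 + Real.pi * I / 2) * jacobiTheta₂_term j (z + 1 / 2 + τ / 2) τ := by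
  rw [expTwoPiI, ← exp_int_mul, theta1Coeff, jacobiTheta₂_term, ← exp_add, ← exp_add]
  congr 1
  ring

lemma summable_norm_theta1Coeff_mul_zpow (hτ : 0 < τ.im) {w : ℂ} (hw : w ≠ 0) :
    Summable fun j => ‖theta1Coeff τ j * w ^ j‖ := by
  obtain ⟨z, rfl⟩ : ∃ z, expTwoPiI z = w := by
    refine ⟨log w / (2 * Real.pi * I), ?_⟩
    rw [expTwoPiI, mul_div_cancel₀ _ two_pi_I_ne_zero, exp_log hw]
  simp only [theta1Coeff_mul_expTwoPiI_zpow]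
  exact (((summable_jacobiTheta₂_term_iff _ _).mpr hτ).mul_left _).norm

lemma theta1_eq_exp_mul_tsum (z τ : ℂ) :
    theta1 z τ = exp (Real.pi * I * z) * ∑' j, theta1Coeff τ j * expTwoPiI z ^ j := by
  rw [theta1, ← tsum_mul_left]
  refine tsum_congr fun j => ?_
  rw [expTwoPiI, ← exp_int_mul, theta1Coeff, ← exp_add, ← exp_add]
  congr 1
  ring

lemma theta1_eq_exp_mul_jacobiTheta₂ (z τ : ℂ) :
    theta1 z τ = exp (Real.pi * I * z) * (exp (Real.pi * I * τ / 4 + Real.pi * I / 2) *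
      jacobiTheta₂ (z + 1 / 2 + τ / 2) τ) := by
  rw [theta1_eq_exp_mul_tsum, jacobiTheta₂]
  simp only [theta1Coeff_mul_expTwoPiI_zpow, tsum_mul_left]

lemma differentiable_theta1 (hτ : 0 < τ.im) : Differentiable ℂ fun z => theta1 z τ := by
  simp only [theta1_eq_exp_mul_jacobiTheta₂]
  intro z
  have h : DifferentiableAt ℂ (fun z => jacobiTheta₂ (z + 1 / 2 + τ / 2) τ) z :=
    (differentiableAt_jacobiTheta₂_fst (z + 1 / 2 + τ / 2) hτ).comp z (f := fun z => z + 1 / 2 + τ / 2)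
      (by fun_prop)
  fun_prop

lemma theta1_zero (τ : ℂ) : theta1 0 τ = 0 := by
  rw [theta1_eq_exp_mul_tsum, expTwoPiI_zero]
  simp [tsum_eq_zero_of_antisymm (theta1Coeff_neg_one_sub τ)]

lemma theta1_add_tau (z τ : ℂ) :
    theta1 (z + τ) τ = -(exp (-(Real.pi * I * τ)) * (expTwoPiI z)⁻¹ * theta1 z τ) := by
  have hq := expTwoPiI_ne_zero τ
  have hx := expTwoPiI_ne_zero z
  have hterm : ∀ j, theta1Coeff τ j * expTwoPiI (z + τ) ^ j =
      -(expTwoPiI τ)⁻¹ * (expTwoPiI z)⁻¹ * (theta1Coeff τ (j + 1) * expTwoPiI z ^ (j + 1)) := by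
    intro j
    rw [theta1Coeff_add_one, expTwoPiI_add, mul_zpow, zpow_add_one₀ hq, zpow_add_one₀ hx]
    field_simp
  have hexp : exp (Real.pi * I * (z + τ)) * (expTwoPiI τ)⁻¹ =
      exp (Real.pi * I * z) * exp (-(Real.pi * I * τ)) := by
    rw [expTwoPiI, ← exp_neg, ← exp_add, ← exp_add]
    congr 1
    ring
  rw [theta1_eq_exp_mul_tsum, theta1_eq_exp_mul_tsum]
  simp only [hterm, tsum_mul_left]
  rw [show ∑' j, theta1Coeff τ (j + 1) * expTwoPiI z ^ (j + 1) =
    ∑' j, theta1Coeff τ j * expTwoPiI z ^ j from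
    (Equiv.addRight (1 : ℤ)).tsum_eq fun j => theta1Coeff τ j * expTwoPiI z ^ j]
  linear_combination (-((expTwoPiI z)⁻¹ * ∑' j, theta1Coeff τ j * expTwoPiI z ^ j)) * hexp

lemma theta1_add_tau_eq_zero_iff (z τ : ℂ) : theta1 (z + τ) τ = 0 ↔ theta1 z τ = 0 := by
  rw [theta1_add_tau]
  simp [exp_ne_zero, expTwoPiI_ne_zero]

lemma integral_jacobiTheta₂ (hτ : 0 < τ.im) : ∫ t in (0 : ℝ)..1, jacobiTheta₂ t τ = 1 := by
  let f : ℤ → C(ℝ, ℂ) := fun n => ⟨fun t => jacobiTheta₂_term n t τ, by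
    unfold jacobiTheta₂_term
    fun_prop⟩
  have hf : ∀ n (t : ℝ), f n t = exp (Real.pi * I * n ^ 2 * τ) * exp (2 * Real.pi * I * n * t) := by
    intro n t
    simp only [f, ContinuousMap.coe_mk, jacobiTheta₂_term, exp_add, mul_comm]
  have hnorm : ∀ n (t : ℝ), ‖f n t‖ = ‖jacobiTheta₂_term n 0 τ‖ := by
    intro n t
    simp only [f, ContinuousMap.coe_mk, norm_jacobiTheta₂_term, ofReal_im, zero_im]
  have hs : Summable fun n => ‖(f n).restrict
      (⟨Set.uIcc (0 : ℝ) 1, isCompact_uIcc⟩ : TopologicalSpace.Compacts ℝ)‖ := by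
    refine Summable.of_nonneg_of_le (fun _ => norm_nonneg _) (fun n => ?_)
      ((summable_jacobiTheta₂_term_iff 0 τ).mpr hτ).norm
    rw [ContinuousMap.norm_le _ (norm_nonneg _)]
    intro t
    exact (hnorm n t).le
  have h := intervalIntegral.hasSum_intervalIntegral_of_summable_norm hs
  have hint : ∀ n, n ≠ 0 → ∫ t in (0 : ℝ)..1, f n t = 0 := by
    intro n hn
    have hc : (2 * Real.pi * I * n : ℂ) ≠ 0 :=
      mul_ne_zero two_pi_I_ne_zero (by exact_mod_cast hn)
    simp only [hf, intervalIntegral.integral_const_mul]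
    rw [integral_exp_mul_complex hc]
    have : exp (2 * Real.pi * I * n * (1 : ℝ)) = 1 := by
      rw [ofReal_one, mul_one, mul_comm, exp_int_mul_two_pi_mul_I]
    rw [this]
    simp
  have h0 := (hasSum_single (f := fun n => ∫ t in (0 : ℝ)..1, f n t) 0 hint).unique h
  have h1 : ∫ t in (0 : ℝ)..1, f 0 t = 1 := by simp [hf]
  rw [← h1]
  exact h0.symm

lemma exists_theta1_ne_zero (hτ : 0 < τ.im) : ∃ z, theta1 z τ ≠ 0 := by
  by_contra! h
  have h0 : ∀ z, jacobiTheta₂ z τ = 0 := by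
    intro z
    have := h (z - 1 / 2 - τ / 2)
    rw [theta1_eq_exp_mul_jacobiTheta₂,
      show z - 1 / 2 - τ / 2 + 1 / 2 + τ / 2 = z by ring] at this
    simpa [exp_ne_zero] using this
  have h1 := integral_jacobiTheta₂ hτ
  simp [h0] at h1

lemma tendsto_add_ofReal_mul_I (z : ℂ) :
    Tendsto (fun t : ℝ => z + t * I) (𝓝[>] 0) (𝓝 z) := by
  have h : Continuous fun t : ℝ => z + t * I := by fun_prop
  simpa using (h.tendsto 0).mono_left nhdsWithin_le_nhds

lemma tendsto_add_ofReal_mul_I_ne (z : ℂ) :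
    Tendsto (fun t : ℝ => z + t * I) (𝓝[>] 0) (𝓝[≠] z) := by
  refine tendsto_nhdsWithin_iff.mpr ⟨tendsto_add_ofReal_mul_I z, ?_⟩
  filter_upwards [self_mem_nhdsWithin] with t ht
  simpa using (Set.mem_Ioi.mp ht).ne'

lemma tendsto_expTwoPiI_add_ofReal_mul_I {z : ℂ} (hz : z.im = 0) :
    Tendsto (fun t : ℝ => expTwoPiI (z + t * I)) (𝓝[>] 0)
      (𝓝[Metric.ball 0 1] (expTwoPiI z)) := by
  refine tendsto_nhdsWithin_iff.mpr
    ⟨(continuous_expTwoPiI.tendsto z).comp (tendsto_add_ofReal_mul_I z), ?_⟩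
  filter_upwards [self_mem_nhdsWithin] with t ht
  rw [mem_ball_zero_iff]
  exact norm_expTwoPiI_lt_one (by simpa [hz] using ht)

lemma not_eventually_theta1_eq_zero (hτ : 0 < τ.im) (z : ℂ) :
    ¬∀ᶠ t : ℝ in 𝓝[>] 0, theta1 (z + t * I) τ = 0 := by
  intro h
  obtain ⟨w, hw⟩ := exists_theta1_ne_zero hτ
  have hA : AnalyticOnNhd ℂ (fun z => theta1 z τ) Set.univ :=
    fun z _ => (differentiable_theta1 hτ).analyticAt z
  exact hw (hA.eqOn_zero_of_preconnected_of_frequently_eq_zero isPreconnected_univ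
    (Set.mem_univ z) ((tendsto_add_ofReal_mul_I_ne z).frequently h.frequently) (Set.mem_univ w))

lemma eventually_im_mem_Ioo (hτ : 0 < τ.im) {z : ℂ} (hz : z.im = 0) :
    ∀ᶠ t : ℝ in 𝓝[>] 0, 0 < (z + t * I).im ∧ (z + t * I).im < τ.im := by
  filter_upwards [Ioo_mem_nhdsGT hτ] with t ht
  simpa [hz] using ht

/-- The kernel as a quotient of theta functions, up to a constant `C`, which is in turn determined
by the residue at the origin. -/
theorem exists_lambertKernel_mul_theta1_eq (hτ : 0 < τ.im) {ν : ℂ} (hν0 : 0 < ν.im)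
    (hν : ν.im < τ.im) :
    ∃ C : ℂ, (∀ z : ℂ, 0 ≤ z.im → z.im < τ.im → expTwoPiI z ≠ 1 →
      lambertKernel (expTwoPiI τ) (expTwoPiI z) (expTwoPiI ν) * theta1 z τ =
        C * theta1 (z + ν) τ) ∧
      theta1'0 τ = -(2 * Real.pi * I) * C * theta1 ν τ := by
  have hq0 := expTwoPiI_ne_zero τ
  have hq := norm_expTwoPiI_lt_one hτ
  have hyq := norm_expTwoPiI_lt hν
  have hy := norm_expTwoPiI_lt_one hν0
  obtain ⟨C, hC⟩ := exists_lambertKernel_mul_tsum_eq hq0 hq hyq hy (theta1Coeff_ne_zero τ)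
    (theta1Coeff_add_one τ) (theta1Coeff_neg_one_sub τ)
    (fun w hw => summable_norm_theta1Coeff_mul_zpow hτ hw)
  have hopen : ∀ z : ℂ, 0 < z.im → z.im < τ.im →
      lambertKernel (expTwoPiI τ) (expTwoPiI z) (expTwoPiI ν) * theta1 z τ =
        C * exp (-(Real.pi * I * ν)) * theta1 (z + ν) τ := by
    intro z hz0 hz
    have hexp : exp (-(Real.pi * I * ν)) * exp (Real.pi * I * (z + ν)) =
        exp (Real.pi * I * z) := by
      rw [← exp_add]
      congr 1
      ring
    have h := hC (expTwoPiI z) (norm_expTwoPiI_lt hz) (norm_expTwoPiI_lt_one hz0)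
    rw [theta1_eq_exp_mul_tsum, theta1_eq_exp_mul_tsum, expTwoPiI_add]
    linear_combination exp (Real.pi * I * z) * h - (C * ∑' j, theta1Coeff τ j *
      (expTwoPiI z * expTwoPiI ν) ^ j) * hexp
  have hcont : Continuous fun z => theta1 z τ := (differentiable_theta1 hτ).continuous
  refine ⟨C * exp (-(Real.pi * I * ν)), ?_, ?_⟩
  · intro z hz0 hz hz1
    rcases hz0.lt_or_eq with hz0 | hz0
    · exact hopen z hz0 hz
    have hE := tendsto_expTwoPiI_add_ofReal_mul_I hz0.symm
    have hK := (tendsto_one_sub_mul_lambertKernel hq0 hyq hy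
      (norm_expTwoPiI_eq_one hz0.symm) hz1).comp hE
    have hL := hK.mul ((hcont.tendsto z).comp (tendsto_add_ofReal_mul_I z))
    have hcontR : Continuous fun w => (1 - expTwoPiI w) *
        (C * exp (-(Real.pi * I * ν)) * theta1 (w + ν) τ) := by
      have := continuous_expTwoPiI
      have : Continuous fun w => theta1 (w + ν) τ := hcont.comp (by fun_prop)
      fun_prop
    have hR := (hcontR.tendsto z).comp (tendsto_add_ofReal_mul_I z)
    have heq := tendsto_nhds_unique_of_eventuallyEq hL hR (by
      filter_upwards [eventually_im_mem_Ioo hτ hz0.symm] with t ht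
      simp only [Function.comp_apply]
      rw [mul_assoc, hopen _ ht.1 ht.2])
    rw [mul_assoc] at heq
    exact mul_left_cancel₀ (sub_ne_zero.mpr hz1.symm) heq
  · have hE := tendsto_expTwoPiI_add_ofReal_mul_I (z := 0) rfl
    rw [expTwoPiI_zero] at hE
    have hK := (tendsto_one_sub_mul_lambertKernel_one hq0 hyq hy).comp hE
    have hd := ((differentiable_theta1 hτ) 0).hasDerivAt.tendsto_slope.comp
      (tendsto_add_ofReal_mul_I_ne 0)
    have he := hasDerivAt_expTwoPiI_zero.tendsto_slope.comp (tendsto_add_ofReal_mul_I_ne 0)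
    have hcont' : Continuous fun w => C * exp (-(Real.pi * I * ν)) * theta1 (w + ν) τ := by
      have : Continuous fun w => theta1 (w + ν) τ := hcont.comp (by fun_prop)
      fun_prop
    have hR := he.neg.mul ((hcont'.tendsto 0).comp (tendsto_add_ofReal_mul_I 0))
    have heq := tendsto_nhds_unique_of_eventuallyEq (hK.mul hd) hR (by
      filter_upwards [eventually_im_mem_Ioo hτ (z := 0) rfl] with t ht
      simp only [Function.comp_apply, slope_def_field, theta1_zero, expTwoPiI_zero]
      linear_combination (1 - expTwoPiI (0 + t * I)) * (0 + t * I - 0 : ℂ)⁻¹ * hopen _ ht.1 ht.2)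
    rw [one_mul, zero_add] at heq
    rw [theta1'0, heq]
    ring

lemma theta1'0_ne_zero (hτ : 0 < τ.im) : theta1'0 τ ≠ 0 := by
  intro h0
  obtain ⟨s, hs, hs'⟩ : ∃ s : ℝ, theta1 (0 + s * I) τ ≠ 0 ∧
      (0 < (0 + s * I).im ∧ (0 + s * I).im < τ.im) :=
    ((not_eventually.mp (not_eventually_theta1_eq_zero hτ 0)).and_eventually
      (eventually_im_mem_Ioo hτ (z := 0) rfl)).exists
  obtain ⟨C, hC, hC'⟩ := exists_lambertKernel_mul_theta1_eq hτ hs'.1 hs'.2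
  have hC0 : C = 0 := by
    rw [h0, eq_comm, mul_eq_zero, mul_eq_zero, neg_eq_zero] at hC'
    exact (hC'.resolve_right hs).resolve_left two_pi_I_ne_zero
  have hE := tendsto_expTwoPiI_add_ofReal_mul_I (z := 0) rfl
  rw [expTwoPiI_zero] at hE
  have hK := (tendsto_one_sub_mul_lambertKernel_one (expTwoPiI_ne_zero τ)
    (norm_expTwoPiI_lt hs'.2) (norm_expTwoPiI_lt_one hs'.1)).comp hE
  refine not_eventually_theta1_eq_zero hτ 0 ?_
  filter_upwards [hK.eventually_ne one_ne_zero, eventually_im_mem_Ioo hτ (z := 0) rfl]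
    with t ht ht'
  rw [Function.comp_apply, mul_ne_zero_iff, sub_ne_zero] at ht
  have := hC _ ht'.1.le ht'.2 ht.1.symm
  rw [hC0, zero_mul] at this
  exact (mul_eq_zero.mp this).resolve_left ht.2

theorem theta1_ne_zero (hτ : 0 < τ.im) {z : ℂ} (hz : z ∉ lattice τ) : theta1 z τ ≠ 0 := by
  revert hz
  refine forall_of_forall_strip hτ (P := fun z => z ∉ lattice τ → theta1 z τ ≠ 0) ?_ ?_ z
  · intro z
    simp only [add_mem_lattice_iff, ne_eq, theta1_add_tau_eq_zero_iff]
  · intro z hz0 hzτ hz h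
    refine not_eventually_theta1_eq_zero hτ z ?_
    filter_upwards [eventually_im_mem_Ioo hτ (z := 0) rfl] with t ht
    rw [zero_add] at ht
    obtain ⟨C, hC, hC'⟩ := exists_lambertKernel_mul_theta1_eq hτ ht.1 ht.2
    have hC0 : C ≠ 0 := by
      rintro rfl
      exact theta1'0_ne_zero hτ (by simpa using hC')
    have := hC z hz0 hzτ (expTwoPiI_ne_one hz)
    rw [h, mul_zero] at this
    exact (mul_eq_zero.mp this.symm).resolve_left hC0

lemma sigmaE_add_tau_right (τ μ z : ℂ) :
    sigmaE τ μ (z + τ) = expTwoPiI μ * sigmaE τ μ z := by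
  have h1 := exp_ne_zero (-(Real.pi * I * τ))
  have h2 := expTwoPiI_ne_zero z
  have h3 := expTwoPiI_ne_zero μ
  rw [sigmaE, sigmaE, add_sub_right_comm, theta1_add_tau, theta1_add_tau, sub_eq_add_neg z μ,
    expTwoPiI_add, expTwoPiI_neg]
  field_simp

lemma sigmaE_add_tau_left (τ μ z : ℂ) :
    sigmaE τ (μ + τ) z = expTwoPiI z * sigmaE τ μ z := by
  have h1 := exp_ne_zero (-(Real.pi * I * τ))
  have h2 := expTwoPiI_ne_zero z
  have h3 := expTwoPiI_ne_zero (-(μ + τ))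
  have e1 : z - μ = z + -(μ + τ) + τ := by ring
  have e2 : -μ = -(μ + τ) + τ := by ring
  rw [sigmaE, sigmaE, e1, theta1_add_tau (z + -(μ + τ)) τ, e2, theta1_add_tau (-(μ + τ)) τ,
    expTwoPiI_add, sub_eq_add_neg]
  field_simp

lemma sigmaE_neg_eq_lambertKernel (hτ : 0 < τ.im) {ν : ℂ} (hν0 : 0 < ν.im) (hν : ν.im < τ.im)
    {z : ℂ} (hz : z ∉ lattice τ) :
    sigmaE τ (-ν) z =
      -(2 * Real.pi * I) * lambertKernel (expTwoPiI τ) (expTwoPiI z) (expTwoPiI ν) := by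
  obtain ⟨C, hC, hC'⟩ := exists_lambertKernel_mul_theta1_eq hτ hν0 hν
  have hθν : theta1 ν τ ≠ 0 := by
    intro h
    exact theta1'0_ne_zero hτ (by simpa [h] using hC')
  revert hz
  refine forall_of_forall_strip hτ (P := fun z => z ∉ lattice τ → sigmaE τ (-ν) z =
    -(2 * Real.pi * I) * lambertKernel (expTwoPiI τ) (expTwoPiI z) (expTwoPiI ν)) ?_ ?_ z
  · intro z
    have h := inv_ne_zero (expTwoPiI_ne_zero ν)
    rw [add_mem_lattice_iff, sigmaE_add_tau_right, expTwoPiI_add,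
      lambertKernel_mul_left (expTwoPiI_ne_zero τ) (expTwoPiI_ne_zero ν), expTwoPiI_neg,
      mul_left_comm _ (expTwoPiI ν)⁻¹, mul_right_inj' h]
  · intro z hz0 hzτ hz
    have hθz := theta1_ne_zero hτ hz
    rw [sigmaE, neg_neg, sub_neg_eq_add, div_eq_iff (mul_ne_zero hθz hθν), hC']
    linear_combination (2 * Real.pi * I) * theta1 ν τ * hC z hz0 hzτ (expTwoPiI_ne_one hz)

lemma summable_lambertKernel_expTwoPiI (hτ : 0 < τ.im) {ν : ℂ} (hν0 : 0 < ν.im)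
    (hν : ν.im < τ.im) (z : ℂ) :
    Summable fun n : ℤ => expTwoPiI ν ^ n / (1 - expTwoPiI z * expTwoPiI τ ^ n) := by
  refine forall_of_forall_strip hτ (P := fun z => Summable fun n : ℤ =>
    expTwoPiI ν ^ n / (1 - expTwoPiI z * expTwoPiI τ ^ n)) ?_ ?_ z
  · intro z
    rw [expTwoPiI_add]
    exact summable_lambertKernel_mul_left_iff (expTwoPiI_ne_zero τ) (expTwoPiI_ne_zero ν)
  · intro z hz0 hz
    refine summable_lambertKernel (expTwoPiI_ne_zero τ) (norm_expTwoPiI_lt hz) ?_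
      (norm_expTwoPiI_lt hν) (norm_expTwoPiI_lt_one hν0)
    rcases hz0.lt_or_eq with h | h
    · exact (norm_expTwoPiI_lt_one h).le
    · exact (norm_expTwoPiI_eq_one h.symm).le

lemma continuousAt_sigmaE_neg (hτ : 0 < τ.im) {z ν : ℂ} (hz : z ∉ lattice τ)
    (hν : ν ∉ lattice τ) : ContinuousAt (fun w => sigmaE τ (-w) z) ν := by
  have hcont : Continuous fun w => theta1 w τ := (differentiable_theta1 hτ).continuous
  have hcont' : Continuous fun w => theta1 (z + w) τ := hcont.comp (by fun_prop)
  have hne := mul_ne_zero (theta1_ne_zero hτ hz) (theta1_ne_zero hτ hν)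
  simp only [sigmaE, neg_neg, sub_neg_eq_add]
  exact ContinuousAt.div (by fun_prop) (by fun_prop) hne

end Theta

lemma lattice_subset_lattice_div (τ : ℂ) {k : ℕ} (hk : 0 < k) :
    lattice τ ⊆ lattice (τ / k) := by
  have hk0 : (k : ℂ) ≠ 0 := by exact_mod_cast hk.ne'
  rintro _ ⟨m, n, rfl⟩
  refine ⟨m, n * k, ?_⟩
  push_cast
  field_simp

lemma sigma_averaging_of_mem_strip {τ : ℂ} {k : ℕ} (hk : 0 < k) {ν z : ℂ}
    (hz : z ∉ lattice (τ / k)) (hν0 : 0 < ν.im) (hν : ν.im < τ.im) :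
    sigmaE τ (-ν) z =
      (1 / (k : ℂ)) * ∑ a ∈ Finset.range k, sigmaE (τ / k) ((-ν + a) / k) z := by
  have hk0 : (k : ℂ) ≠ 0 := by exact_mod_cast hk.ne'
  have hkR : (0 : ℝ) < k := by exact_mod_cast hk
  have hτk : 0 < (τ / k).im := by
    rw [div_natCast_im]
    exact div_pos (hν0.trans hν) hkR
  have him : ∀ a : ℕ, ((ν - a) / k).im = ν.im / k := by
    intro a
    simp [div_natCast_im]
  have him0 : ∀ a : ℕ, 0 < ((ν - a) / k).im := fun a => by
    rw [him]
    exact div_pos hν0 hkR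
  have him1 : ∀ a : ℕ, ((ν - a) / k).im < (τ / k).im := fun a => by
    rw [him, div_natCast_im]
    gcongr
  have hpow : ∀ w : ℂ, expTwoPiI (w / k) ^ k = expTwoPiI w := by
    intro w
    rw [expTwoPiI, ← exp_nat_mul, expTwoPiI]
    congr 1
    field_simp
  have hroot : ∀ a : ℕ, expTwoPiI ((ν - a) / k) =
      expTwoPiI (ν / k) * (exp (2 * Real.pi * I / k))⁻¹ ^ a := by
    intro a
    rw [sub_div, sub_eq_add_neg, expTwoPiI_add, expTwoPiI_neg, inv_pow, ← exp_nat_mul,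
      expTwoPiI.eq_def (a / k)]
    congr 3
    ring
  have hterm : ∀ a ∈ Finset.range k, sigmaE (τ / k) ((-ν + a) / k) z =
      -(2 * Real.pi * I) * lambertKernel (expTwoPiI (τ / k)) (expTwoPiI z)
        (expTwoPiI (ν / k) * (exp (2 * Real.pi * I / k))⁻¹ ^ a) := by
    intro a _
    rw [show (-ν + a) / k = -((ν - a) / k) by ring,
      sigmaE_neg_eq_lambertKernel hτk (him0 a) (him1 a) hz, hroot]
  rw [Finset.sum_congr rfl hterm, ← Finset.mul_sum,
    sum_lambertKernel_primitiveRoot hk (isPrimitiveRoot_exp k hk.ne').inv, hpow, hpow,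
    sigmaE_neg_eq_lambertKernel (hν0.trans hν) hν0 hν
      fun h => hz (lattice_subset_lattice_div τ hk h)]
  · field_simp
  · intro a _
    rw [← hroot]
    exact summable_lambertKernel_expTwoPiI hτk (him0 a) (him1 a) z

/-- the averaging identity
σ_μ(z,τ) = (1/k)·Σ_{a=0}^{k−1} σ_{(μ+a)/k}(z, τ/k). -/
theorem sigma_averaging (τ : ℂ) (hτ : 0 < τ.im) (k : ℕ) (hk : 0 < k) (μ z : ℂ)
    (hz : z ∉ lattice (τ / k)) (hμ : μ ∉ lattice τ)
    (hμa : ∀ a ∈ Finset.range k, (μ + a) / k ∉ lattice (τ / k)) :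
    sigmaE τ μ z = (1 / (k : ℂ)) * ∑ a ∈ Finset.range k, sigmaE (τ / k) ((μ + a) / k) z := by
  have hkR : (0 : ℝ) < k := by exact_mod_cast hk
  have hτk : 0 < (τ / k).im := by
    rw [div_natCast_im]
    exact div_pos hτ hkR
  obtain ⟨ν, rfl⟩ : ∃ ν, μ = -ν := ⟨-μ, (neg_neg μ).symm⟩
  revert hμ hμa
  refine forall_of_forall_strip hτ (P := fun ν => -ν ∉ lattice τ →
    (∀ a ∈ Finset.range k, (-ν + a) / k ∉ lattice (τ / k)) → sigmaE τ (-ν) z =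
      (1 / (k : ℂ)) * ∑ a ∈ Finset.range k, sigmaE (τ / k) ((-ν + a) / k) z) ?_ ?_ ν
  · intro ν
    have h1 : -ν = -(ν + τ) + τ := by ring
    have h2 : ∀ a : ℕ, (-ν + a) / k = (-(ν + τ) + a) / k + τ / k := fun a => by ring
    simp only [h2, add_mem_lattice_iff, sigmaE_add_tau_left, ← Finset.mul_sum]
    rw [h1, add_mem_lattice_iff, sigmaE_add_tau_left, mul_left_comm,
      mul_right_inj' (expTwoPiI_ne_zero z)]
  · intro ν hν0 hν hμ hμa
    rcases hν0.lt_or_eq with hν0 | hν0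
    · exact sigma_averaging_of_mem_strip hk hz hν0 hν
    have hzτ : z ∉ lattice τ := fun h => hz (lattice_subset_lattice_div τ hk h)
    have hL := (continuousAt_sigmaE_neg hτ hzτ (neg_mem_lattice_iff.not.mp hμ)).tendsto.comp
      (tendsto_add_ofReal_mul_I ν)
    have hcont : ContinuousAt (fun w => (1 / (k : ℂ)) * ∑ a ∈ Finset.range k,
        sigmaE (τ / k) ((-w + a) / k) z) ν := by
      refine ContinuousAt.mul continuousAt_const (tendsto_finsetSum _ fun a ha => ?_)
      have h3 : ∀ w : ℂ, (-w + a) / k = -((w - a) / k) := fun w => by ring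
      have h4 := hμa a ha
      simp only [h3] at h4 ⊢
      exact ContinuousAt.comp (f := fun w : ℂ => (w - a) / k)
        (continuousAt_sigmaE_neg hτk hz (neg_mem_lattice_iff.not.mp h4)) (by fun_prop)
    refine tendsto_nhds_unique_of_eventuallyEq hL
      (hcont.tendsto.comp (tendsto_add_ofReal_mul_I ν)) ?_
    filter_upwards [eventually_im_mem_Ioo hτ hν0.symm] with t ht
    exact sigma_averaging_of_mem_strip hk hz ht.1 ht.2
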